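/- For every c < −2 and every x ∈ ℝ with x ∉ Λ_c, the sequence F_cⁿ(x) diverges to infinity (F_cⁿ(x) → +∞ as n → ∞). Hence Λ_c is exactly the set of points of ℝ whose orbit under F_c is bounded. -/

import Mathlib

open Filter

/-- Beyond a fixed point `p ≥ 1` of `y ↦ y ^ 2 + c`, iterates grow at least linearly. -/
theorem le_iterate_sq_add {c p d : ℝ} (hp : 1 ≤ p) (hfix : p ^ 2 + c = p) (hd : 0 ≤ d) (n : ℕ) :
    p + (n + 1) * d ≤ (fun y : ℝ => y ^ 2 + c)^[n] (p + d) := by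
  induction n with
  | zero => simp
  | succ n ih =>
    rw [Function.iterate_succ_apply']
    have hn : 0 ≤ (n : ℝ) * d := by positivity
    push_cast
    nlinarith [mul_nonneg (sub_nonneg.2 hp) (by positivity : 0 ≤ ((n : ℝ) + 1) * d),
      sq_nonneg (((n : ℝ) + 1) * d),
      pow_le_pow_left₀ (by positivity : 0 ≤ p + ((n : ℝ) + 1) * d) ih 2]

theorem tendsto_iterate_sq_add_of_lt {c p y : ℝ} (hp : 1 ≤ p) (hfix : p ^ 2 + c = p)
    (hy : p < y) : Tendsto (fun n : ℕ => (fun y : ℝ => y ^ 2 + c)^[n] y) atTop atTop := by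
  have hd : 0 < y - p := sub_pos.2 hy
  have hlin : Tendsto (fun n : ℕ => p + ((n : ℝ) + 1) * (y - p)) atTop atTop :=
    tendsto_atTop_add_const_left _ _
      ((tendsto_atTop_add_const_right _ _ tendsto_natCast_atTop_atTop).atTop_mul_const hd)
  refine tendsto_atTop_mono (fun n => ?_) hlin
  simpa using le_iterate_sq_add hp hfix hd.le n

theorem tendsto_iterate_sq_add_of_notMem {c p x : ℝ} (hp : 1 ≤ p) (hfix : p ^ 2 + c = p) {n : ℕ}
    (hn : (fun y : ℝ => y ^ 2 + c)^[n] x ∉ Set.Icc (-p) p) :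
    Tendsto (fun n : ℕ => (fun y : ℝ => y ^ 2 + c)^[n] x) atTop atTop := by
  rw [Set.mem_Icc, ← abs_le, not_le] at hn
  rw [← tendsto_add_atTop_iff_nat (n + 1)]
  simp only [Function.iterate_add_apply _ _ (n + 1), Function.iterate_succ_apply' _ n]
  refine tendsto_iterate_sq_add_of_lt hp hfix ?_
  have := pow_lt_pow_left₀ hn (by linarith) two_ne_zero
  rw [sq_abs] at this
  linarith

/-- For every `c < -2` and every `x ∉ Λ_c`, the iterates `F_c^[n] x` tend to `+∞`.
Hence `Λ_c` is exactly the set of points of `ℝ` whose orbit under `F_c` is bounded. -/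
theorem stmt12 (c : ℝ) (hc : c < -2) (p : ℝ) (hp : p = (1 + Real.sqrt (1 - 4*c)) / 2)
    (Λ : Set ℝ)
    (hΛ : Λ = {x ∈ Set.Icc (-p) p |
      ∀ n : ℕ, (fun y : ℝ => y^2 + c)^[n] x ∈ Set.Icc (-p) p}) :
    (∀ x : ℝ, x ∉ Λ →
      Tendsto (fun n : ℕ => (fun y : ℝ => y^2 + c)^[n] x) atTop atTop) ∧
    Λ = {x : ℝ | ∃ M : ℝ, ∀ n : ℕ, |(fun y : ℝ => y^2 + c)^[n] x| ≤ M} := by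
  have hsq : Real.sqrt (1 - 4 * c) ^ 2 = 1 - 4 * c := Real.sq_sqrt (by linarith)
  have hp1 : 1 ≤ p := by
    have : 1 ≤ Real.sqrt (1 - 4 * c) := Real.one_le_sqrt.2 (by linarith)
    linarith
  have hfix : p ^ 2 + c = p := by
    rw [hp]
    linarith
  have hdiv : ∀ x : ℝ, x ∉ Λ →
      Tendsto (fun n : ℕ => (fun y : ℝ => y^2 + c)^[n] x) atTop atTop := by
    intro x hx
    obtain ⟨n, hn⟩ : ∃ n : ℕ, (fun y : ℝ => y^2 + c)^[n] x ∉ Set.Icc (-p) p := by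
      by_contra! h
      exact hx (hΛ ▸ ⟨h 0, h⟩)
    exact tendsto_iterate_sq_add_of_notMem hp1 hfix hn
  refine ⟨hdiv, Set.Subset.antisymm (fun x hx => ?_) ?_⟩
  · rw [hΛ] at hx
    exact ⟨p, fun n => abs_le.2 (hx.2 n)⟩
  · rintro x ⟨M, hM⟩
    by_contra hx
    obtain ⟨n, hn⟩ := ((hdiv x hx).eventually_gt_atTop M).exists
    exact absurd ((le_abs_self _).trans (hM n)) (not_le.2 hn)
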